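/- arXiv:1305.6190 — 2 statements merged into one kernel-verified Lean document; each statement's English description precedes it below -/
import Mathlib

section
/- Let m ≤ n and let β ∈ ℂ^{2^n} be any vector. Then the probability weight of all-zero outcomes on the first m bits satisfies Σ_{x : x_i = 0 for all i < m} |β_x|² = 2^{-m} Σ_{t ∈ (ZMod 2)^m} ⟨β, Z̃(t) β⟩, where ⟨·,·⟩ is the standard Hermitian inner product on ℂ^{2^n} and the left-hand side is coerced to ℂ. -/
open Matrix BigOperators Complex

noncomputable section

/-- The 2×2 Pauli X matrix, indexed by `ZMod 2`. -/
def pX : Matrix (ZMod 2) (ZMod 2) ℂ := !![0, 1; 1, 0]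

/-- The 2×2 Pauli Z matrix, indexed by `ZMod 2`. -/
def pZ : Matrix (ZMod 2) (ZMod 2) ℂ := !![1, 0; 0, -1]

/-- `X(a) = X^{a_1} ⊗ ⋯ ⊗ X^{a_n}` as a `2^n × 2^n` matrix indexed by bit strings. -/
def XK {n : ℕ} (a : Fin n → ZMod 2) :
    Matrix (Fin n → ZMod 2) (Fin n → ZMod 2) ℂ :=
  Matrix.of fun y x => ∏ i, (pX ^ (a i).val) (y i) (x i)

/-- `Z(a) = Z^{a_1} ⊗ ⋯ ⊗ Z^{a_n}` as a `2^n × 2^n` matrix indexed by bit strings. -/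
def ZK {n : ℕ} (a : Fin n → ZMod 2) :
    Matrix (Fin n → ZMod 2) (Fin n → ZMod 2) ℂ :=
  Matrix.of fun y x => ∏ i, (pZ ^ (a i).val) (y i) (x i)

/-- Standard (computational) basis vector `e_x`. -/
def basisVec {ι : Type*} [DecidableEq ι] (x : ι) : ι → ℂ :=
  fun y => if y = x then 1 else 0

/-- Standard Hermitian inner product, conjugate-linear in the first argument. -/
def innerC {ι : Type*} [Fintype ι] (v w : ι → ℂ) : ℂ :=
  ∑ x, (starRingEnd ℂ) (v x) * w x

/-- Extension of a bit string in `(ZMod 2)^m` to `(ZMod 2)^n` by zeros (for `m ≤ n`). -/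
def extZ {n m : ℕ} (hm : m ≤ n) (t : Fin m → ZMod 2) : Fin n → ZMod 2 :=
  fun i => if h : (i : ℕ) < m then t ⟨i, h⟩ else 0

/-- The diagonal entry at `x` of the power `Z^a` of the Pauli Z matrix. -/
def zPhase (a x : ZMod 2) : ℂ := if x = 0 then 1 else (-1) ^ a.val

theorem pZ_pow_apply (a y x : ZMod 2) :
    (pZ ^ a.val) y x = if y = x then zPhase a x else 0 := by
  have h : pZ = Matrix.diagonal (fun x : ZMod 2 => if x = 0 then (1 : ℂ) else -1) := by
    ext y x
    rw [Matrix.diagonal_apply]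
    fin_cases y <;> fin_cases x <;> rfl
  rw [h, Matrix.diagonal_pow, Matrix.diagonal_apply]
  by_cases hyx : y = x
  · subst hyx
    by_cases hy : y = 0 <;> simp [zPhase, hy]
  · simp [hyx]

theorem ZK_eq_diagonal {n : ℕ} (a : Fin n → ZMod 2) :
    ZK a = Matrix.diagonal fun x => ∏ i, zPhase (a i) (x i) := by
  ext y x
  simp only [ZK, Matrix.of_apply, pZ_pow_apply, Matrix.diagonal_apply]
  by_cases h : y = x
  · simp [h]
  · obtain ⟨i, hi⟩ := Function.ne_iff.mp h
    rw [if_neg h]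
    exact Finset.prod_eq_zero (Finset.mem_univ i) (if_neg hi)

theorem innerC_ZK_mulVec {n : ℕ} (a : Fin n → ZMod 2) (β : (Fin n → ZMod 2) → ℂ) :
    innerC β ((ZK a).mulVec β) = ∑ x, (∏ i, zPhase (a i) (x i)) * (‖β x‖ : ℂ) ^ 2 := by
  simp only [innerC, ZK_eq_diagonal, Matrix.mulVec_diagonal]
  refine Finset.sum_congr rfl fun x _ => ?_
  rw [mul_left_comm, Complex.conj_mul']

theorem zPhase_zero_left (x : ZMod 2) : zPhase 0 x = 1 := by
  simp [zPhase]

theorem sum_zPhase (x : ZMod 2) : ∑ a, zPhase a x = if x = 0 then 2 else 0 := by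
  have h : (Finset.univ : Finset (ZMod 2)) = {0, 1} := rfl
  rw [h, Finset.sum_pair zero_ne_one]
  by_cases hx : x = 0
  · simp [zPhase, hx, one_add_one_eq_two]
  · simp [zPhase, hx, ZMod.val_one]

theorem prod_zPhase_extZ {n m : ℕ} (hm : m ≤ n) (t : Fin m → ZMod 2) (x : Fin n → ZMod 2) :
    ∏ i, zPhase (extZ hm t i) (x i) = ∏ j, zPhase (t j) (x (Fin.castLE hm j)) := by
  obtain ⟨k, rfl⟩ := Nat.exists_eq_add_of_le hm
  simp only [Fin.prod_univ_add, extZ, Fin.val_castAdd, Fin.is_lt, dite_true, Fin.eta,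
    Fin.val_natAdd, Nat.not_lt.mpr (Nat.le_add_right _ _), dite_false, zPhase_zero_left,
    Finset.prod_const_one, mul_one]
  rfl

/-- Averaging the characters of the first `m` bits gives the indicator that these bits vanish. -/
theorem sum_prod_zPhase_extZ {n m : ℕ} (hm : m ≤ n) (x : Fin n → ZMod 2) :
    ∑ t : Fin m → ZMod 2, ∏ i, zPhase (extZ hm t i) (x i) =
      if ∀ i : Fin n, (i : ℕ) < m → x i = 0 then 2 ^ m else 0 := by
  simp only [prod_zPhase_extZ]
  rw [← Fintype.prod_sum fun j a => zPhase a (x (Fin.castLE hm j))]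
  simp only [sum_zPhase]
  split_ifs with h
  · simp [h]
  · push Not at h
    obtain ⟨i, hi, hx⟩ := h
    exact Finset.prod_eq_zero (Finset.mem_univ (⟨i, hi⟩ : Fin m)) (if_neg hx)

theorem stmt9 (n m : ℕ) (hm : m ≤ n) (β : (Fin n → ZMod 2) → ℂ) :
    ((∑ x ∈ Finset.univ.filter (fun x : Fin n → ZMod 2 => ∀ i : Fin n, (i : ℕ) < m → x i = 0),
        ‖β x‖ ^ 2 : ℝ) : ℂ) =
      ((2 : ℂ) ^ m)⁻¹ * ∑ t : Fin m → ZMod 2, innerC β ((ZK (extZ hm t)).mulVec β) := by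
  simp only [innerC_ZK_mulVec]
  rw [Finset.sum_comm]
  simp only [← Finset.sum_mul, sum_prod_zPhase_extZ]
  rw [Finset.mul_sum, Finset.sum_filter]
  push_cast
  refine Finset.sum_congr rfl fun x _ => ?_
  split_ifs <;> simp
end
end

section
/- Let f : (ZMod 2)^n → ZMod 2. Index ℂ^{2^{n+1}} by pairs (x, y) with x ∈ (ZMod 2)^n and y ∈ ZMod 2, and let A_f be the permutation matrix acting by A_f e_{(x,y)} = e_{(x, y + f(x))}. Let ψ = A_f ((H^{⊗n} e_0) ⊗ e_0), where e_0 denotes the all-zeros basis vector in the respective space. Then the probability of obtaining outcome 1 when the last qubit is measured in the computational basis satisfies Σ_{x ∈ (ZMod 2)^n} |ψ_{(x,1)}|² = |{x : f(x) = 1}| / 2^n. -/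
open Matrix BigOperators Complex

noncomputable section

/-- The 2×2 Hadamard gate. -/
def Hgate : Matrix (ZMod 2) (ZMod 2) ℂ := (Real.sqrt 2 : ℂ)⁻¹ • !![1, 1; 1, -1]

/-- The n-fold Kronecker power `H^{⊗n}`. -/
def HKron (n : ℕ) : Matrix (Fin n → ZMod 2) (Fin n → ZMod 2) ℂ :=
  Matrix.of fun y x => ∏ i, Hgate (y i) (x i)

theorem mulVec_basisVec {ι κ : Type*} [Fintype κ] [DecidableEq κ]
    (A : Matrix ι κ ℂ) (k : κ) : A.mulVec (basisVec k) = fun i => A i k := by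
  ext i
  simp [mulVec, dotProduct, basisVec]

theorem Hgate_apply_zero (y : ZMod 2) : Hgate y 0 = (Real.sqrt 2 : ℂ)⁻¹ := by
  have h : ∀ y : ZMod 2, y = 0 ∨ y = 1 := by decide
  obtain rfl | rfl := h y
  · change (Real.sqrt 2 : ℂ)⁻¹ * 1 = _
    rw [mul_one]
  · change (Real.sqrt 2 : ℂ)⁻¹ * 1 = _
    rw [mul_one]

theorem HKron_apply_zero {n : ℕ} (y : Fin n → ZMod 2) :
    HKron n y 0 = ((Real.sqrt 2 : ℂ)⁻¹) ^ n := by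
  simp [HKron, Hgate_apply_zero]

theorem norm_HKron_apply_zero_sq {n : ℕ} (y : Fin n → ZMod 2) :
    ‖HKron n y 0‖ ^ 2 = 1 / 2 ^ n := by
  rw [HKron_apply_zero, norm_pow, norm_inv, Complex.norm_real, Real.norm_eq_abs,
    abs_of_nonneg (Real.sqrt_nonneg 2), pow_right_comm, inv_pow,
    Real.sq_sqrt (by norm_num), inv_pow, one_div]

/-- Applying the oracle matrix to `v ⊗ e_0` moves the weight of `x` to the index `(x, f x)`. -/
theorem oracle_mulVec_apply {ι : Type*} [Fintype ι] [DecidableEq ι]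
    (f : ι → ZMod 2) (v : ι → ℂ) (x : ι) (y : ZMod 2) :
    ((Matrix.of fun p q : ι × ZMod 2 =>
          if p = (q.1, q.2 + f q.1) then (1 : ℂ) else 0).mulVec
        (fun p => v p.1 * basisVec (0 : ZMod 2) p.2)) (x, y) =
      if f x = y then v x else 0 := by
  simp only [mulVec, dotProduct, Matrix.of_apply, basisVec, Fintype.sum_prod_type,
    mul_ite, mul_one, mul_zero, Finset.sum_ite_eq', Finset.mem_univ, if_true, zero_add,
    ite_mul, one_mul, zero_mul, Prod.mk.injEq, ite_and, Finset.sum_ite_eq, eq_comm (a := y)]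

theorem stmt17 (n : ℕ) (f : (Fin n → ZMod 2) → ZMod 2) :
    (∑ x : Fin n → ZMod 2,
        ‖((Matrix.of fun p q : (Fin n → ZMod 2) × ZMod 2 =>
              if p = (q.1, q.2 + f q.1) then (1 : ℂ) else 0).mulVec
            (fun p => (HKron n).mulVec (basisVec (0 : Fin n → ZMod 2)) p.1 *
              basisVec (0 : ZMod 2) p.2)) (x, 1)‖ ^ 2) =
      ((Finset.univ.filter fun x : Fin n → ZMod 2 => f x = 1).card : ℝ) / 2 ^ n := by
  simp only [mulVec_basisVec]
  simp_rw [oracle_mulVec_apply f (fun x => HKron n x 0)]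
  calc _ = ∑ x : Fin n → ZMod 2, if f x = 1 then (1 / 2 ^ n : ℝ) else 0 :=
        Finset.sum_congr rfl fun x _ => by
          split_ifs
          · exact norm_HKron_apply_zero_sq x
          · simp
    _ = _ := by
        rw [← Finset.sum_filter, Finset.sum_const, nsmul_eq_mul, mul_one_div]
end
end
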